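/- Let G be a finite simple graph with a unique maximum independent set I, let v ∈ I have MDI conditions in G, and let x be a vertex with x ∉ N(v) ∪ I. Then in the induced subgraph G − x (obtained by deleting x), v still has MDI conditions and I is still the unique maximum independent set. -/

import Mathlib

open SimpleGraph Finset

variable {V : Type*}

/-- The number of neighbours of `x` inside the vertex set `A`
(i.e. the degree of `x` towards `A`, which for `x ∈ A` is its degree
in the subgraph induced on `A`). -/
noncomputable def degIn (G : SimpleGraph V) (A : Finset V) (x : V) : ℕ :=
  {y ∈ (A : Set V) | G.Adj x y}.ncard

/-- `s` is an independent set of vertices: pairwise nonadjacent. -/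
def IsIndepF (G : SimpleGraph V) (s : Finset V) : Prop :=
  ∀ a ∈ s, ∀ b ∈ s, ¬ G.Adj a b

/-- The independence number of the subgraph of `G` induced on `A`:
the maximum size of an independent set contained in `A`. -/
noncomputable def indepNumOn (G : SimpleGraph V) (A : Finset V) : ℕ :=
  sSup {n | ∃ s : Finset V, s ⊆ A ∧ IsIndepF G s ∧ s.card = n}

/-- `s` is a maximum independent set of the subgraph of `G` induced on `A`. -/
def MaxIndepOn (G : SimpleGraph V) (A s : Finset V) : Prop :=
  s ⊆ A ∧ IsIndepF G s ∧ s.card = indepNumOn G A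

/-- `v` has MDI conditions in the subgraph of `G` induced on `A`:
`v` has maximum degree there and belongs to every maximum independent set. -/
def MDIOn (G : SimpleGraph V) (A : Finset V) (v : V) : Prop :=
  v ∈ A ∧ (∀ y ∈ A, degIn G A y ≤ degIn G A v) ∧
    ∀ s : Finset V, MaxIndepOn G A s → v ∈ s

theorem bddAbove_indepCards (G : SimpleGraph V) (A : Finset V) :
    BddAbove {n | ∃ s : Finset V, s ⊆ A ∧ IsIndepF G s ∧ s.card = n} :=
  ⟨A.card, by rintro n ⟨s, hs, -, rfl⟩; exact card_le_card hs⟩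

theorem IsIndepF.card_le_indepNumOn {G : SimpleGraph V} {A s : Finset V}
    (hs : IsIndepF G s) (hsA : s ⊆ A) : s.card ≤ indepNumOn G A :=
  le_csSup (bddAbove_indepCards G A) ⟨s, hsA, hs, rfl⟩

theorem indepNumOn_mono (G : SimpleGraph V) {A B : Finset V} (h : B ⊆ A) :
    indepNumOn G B ≤ indepNumOn G A :=
  csSup_le_csSup (bddAbove_indepCards G A)
    ⟨0, ∅, empty_subset B, by simp [IsIndepF], card_empty⟩
    fun _ ⟨s, hs, hi, hc⟩ => ⟨s, hs.trans h, hi, hc⟩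

/-- A maximum independent set that survives in a smaller vertex set keeps the independence
number unchanged. -/
theorem MaxIndepOn.indepNumOn_eq {G : SimpleGraph V} {A B s : Finset V}
    (hs : MaxIndepOn G A s) (hsB : s ⊆ B) (hBA : B ⊆ A) :
    indepNumOn G B = indepNumOn G A :=
  (indepNumOn_mono G hBA).antisymm (hs.2.2 ▸ hs.2.1.card_le_indepNumOn hsB)

theorem degIn_mono (G : SimpleGraph V) {A B : Finset V} (h : B ⊆ A) (y : V) :
    degIn G B y ≤ degIn G A y :=
  Set.ncard_le_ncard (fun _ hz => ⟨h hz.1, hz.2⟩) (A.finite_toSet.subset fun _ hz => hz.1)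

theorem degIn_erase_of_not_adj [DecidableEq V] {G : SimpleGraph V} {v x : V}
    (h : ¬ G.Adj v x) (A : Finset V) : degIn G (A.erase x) v = degIn G A v := by
  unfold degIn
  congr 1
  ext y
  simp only [coe_erase, Set.mem_sdiff, Set.mem_singleton_iff, Set.mem_ofPred_eq]
  exact ⟨fun hy => ⟨hy.1.1, hy.2⟩, fun hy => ⟨⟨hy.1, fun e => h (e ▸ hy.2)⟩, hy.2⟩⟩

/-- Lemma 4 in the paper: if `I` is the unique maximum independent set,
`v ∈ I` has MDI conditions, and `x ∉ N(v) ∪ I`, then after deleting `x` the vertex `v`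
still has MDI conditions and `I` is still the unique maximum independent set. -/
theorem mdi_of_delete_outside [Fintype V] [DecidableEq V] (G : SimpleGraph V)
    (I : Finset V) (v x : V)
    (hI : MaxIndepOn G Finset.univ I)
    (huniq : ∀ J : Finset V, MaxIndepOn G Finset.univ J → J = I)
    (hvI : v ∈ I) (hMDI : MDIOn G Finset.univ v)
    (hxN : ¬ G.Adj v x) (hxI : x ∉ I) :
    MDIOn G (Finset.univ.erase x) v ∧ MaxIndepOn G (Finset.univ.erase x) I ∧
      ∀ J : Finset V, MaxIndepOn G (Finset.univ.erase x) J → J = I := by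
  have hBA : univ.erase x ⊆ univ := erase_subset x univ
  have hIB : I ⊆ univ.erase x := subset_erase.2 ⟨subset_univ I, hxI⟩
  have hnum := hI.indepNumOn_eq hIB hBA
  have huniq' : ∀ J : Finset V, MaxIndepOn G (univ.erase x) J → J = I := fun J hJ =>
    huniq J ⟨subset_univ J, hJ.2.1, hJ.2.2.trans hnum⟩
  refine ⟨⟨hIB hvI, fun y _ => ?_, fun s hs => huniq' s hs ▸ hvI⟩,
    ⟨hIB, hI.2.1, hI.2.2.trans hnum.symm⟩, huniq'⟩
  rw [degIn_erase_of_not_adj hxN]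
  exact (degIn_mono G hBA y).trans (hMDI.2.1 y (mem_univ y))
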